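/- Let F ⊆ P²(F₄) be a four-point subset having exactly one collinear triple of points. Then the number of words c ∈ Pow(P²(F₄)) of weight 6 that are centers of Cremona transformation with respect to C_F is exactly 1374. -/

import Mathlib

/-- An `F`-rational line in the projective plane over `F`: the vanishing set of a nonzero
linear functional. -/
def IsProjLine (F : Type*) [Field F] (L : Set (Projectivization F (Fin 3 → F))) : Prop :=
  ∃ φ : (Fin 3 → F) →ₗ[F] F, φ ≠ 0 ∧ L = {P | φ P.rep = 0}

/-- A set of points of the projective plane is collinear if it is contained in a line. -/
def CollinSet (F : Type*) [Field F] (T : Set (Projectivization F (Fin 3 → F))) : Prop :=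
  ∃ L, IsProjLine F L ∧ T ⊆ L

/-- The Dolgachev–Kondō code `C_DK ⊆ Pow(P²(F₄))`: the `F₂`-linear span of the (indicator
functions of the) point sets of the `F₄`-rational lines. -/
noncomputable def CDK (F : Type*) [Field F] :
    Submodule (ZMod 2) (Projectivization F (Fin 3 → F) → ZMod 2) :=
  Submodule.span (ZMod 2)
    {w | ∃ L : Set (Projectivization F (Fin 3 → F)), IsProjLine F L ∧
      w = Set.indicator L (fun _ => (1 : ZMod 2))}

/-- The code `C_F = {w ∈ C_DK : |w ∩ F| even}`: the condition `|w ∩ F| ≡ 0 (mod 2)` is the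
vanishing of the `F₂`-linear functional `w ↦ ∑_{x ∈ F} w(x)`. -/
noncomputable def CF (F : Type*) [Field F] (Fs : Finset (Projectivization F (Fin 3 → F))) :
    Submodule (ZMod 2) (Projectivization F (Fin 3 → F) → ZMod 2) :=
  CDK F ⊓ LinearMap.ker (∑ x ∈ Fs, LinearMap.proj x)

/-- The weight of a word `w ∈ Pow(S) = F₂^S`: the cardinality of its support. -/
noncomputable def wt {S : Type*} (w : S → ZMod 2) : ℕ := {x | w x = 1}.ncard

/-- A linear word of a code: a word of the code of weight 5. -/
def IsLinearWord {S : Type*} (C : Submodule (ZMod 2) (S → ZMod 2)) (w : S → ZMod 2) : Prop :=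
  w ∈ C ∧ wt w = 5

/-- A quadratic word of a code: a word of the code of weight 8 which is not the sum of two
linear words of the code. -/
def IsQuadraticWord {S : Type*} (C : Submodule (ZMod 2) (S → ZMod 2)) (w : S → ZMod 2) : Prop :=
  w ∈ C ∧ wt w = 8 ∧
    ¬ ∃ l₁ l₂ : S → ZMod 2, IsLinearWord C l₁ ∧ IsLinearWord C l₂ ∧ w = l₁ + l₂

/-- A center of Cremona transformation with respect to a code `C`: a word of weight 6 which
meets every linear word of `C` in at most 2 points and every quadratic word of `C` in at
most 4 points. -/
def IsCremonaCenter {S : Type*} (C : Submodule (ZMod 2) (S → ZMod 2)) (c : S → ZMod 2) :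
    Prop :=
  wt c = 6 ∧
    (∀ l, IsLinearWord C l → ({x | c x = 1} ∩ {x | l x = 1}).ncard ≤ 2) ∧
    (∀ q, IsQuadraticWord C q → ({x | c x = 1} ∩ {x | q x = 1}).ncard ≤ 4)

/-! ### The plane over the four-element field in coordinates

The elements `0, 1, ω, ω + 1` of the field are numbered by `Fin 4`, so that addition is the
bitwise exclusive or; words are encoded by the binary digits of natural numbers. -/

/-- Multiplication of the four-element field on `Fin 4`. -/
def mul4 (a b : Fin 4) : Fin 4 :=
  if a = 0 ∨ b = 0 then 0 else ⟨(a.val + b.val + 1) % 3 + 1, by omega⟩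

/-- Normalized homogeneous coordinates of the 21 points of the projective plane. -/
def coords (i : Fin 21) : Fin 3 → Fin 4 :=
  if i.val < 16 then ![1, ⟨i / 4 % 4, by omega⟩, ⟨i % 4, by omega⟩]
  else if i.val < 20 then ![0, 1, ⟨i % 4, by omega⟩] else ![0, 0, 1]

/-- The value of the linear form with coefficients `a` at the vector `p`. -/
def dot4 (a p : Fin 3 → Fin 4) : Fin 4 :=
  mul4 (a 0) (p 0) ^^^ mul4 (a 1) (p 1) ^^^ mul4 (a 2) (p 2)

/-- The `i`-th binary digit of `n`. -/
def bit (n i : ℕ) : ℕ := n / 2 ^ i % 2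

/-- The encoding of the zero set of the linear form with coefficients `a`. -/
def lineMask (a : Fin 3 → Fin 4) : ℕ :=
  ((List.finRange 21).map fun i => bif dot4 a (coords i) == 0 then 2 ^ i.val else 0).sum

/-- All sums of subfamilies of a list of words. -/
def combos : List ℕ → List ℕ
  | [] => [0]
  | b :: l => combos l ++ (combos l).map (b ^^^ ·)

/-- The number of ones among the first 21 binary digits. -/
def weight (n : ℕ) : ℕ := ((List.finRange 21).map fun i : Fin 21 => bit n i).sum

/-- Ten lines whose words form a basis of the Dolgachev–Kondō code. -/
def basisMasks : List ℕ :=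
  ([0, 1, 2, 3, 4, 5, 6, 8, 12, 16] : List (Fin 21)).map fun i => lineMask (coords i)

/-- The encodings of the words meeting the points `(1,0,0)`, `(1,1,0)`, `(0,1,0)`, `(0,0,1)`
evenly. -/
def codeMasks : List ℕ :=
  (combos basisMasks).filter fun n => (bit n 0 + bit n 4 + bit n 16 + bit n 20) % 2 == 0

/-- The encodings of the linear words. -/
def linMasks : List ℕ := codeMasks.filter fun n => weight n == 5

/-- The encodings of the quadratic words. -/
def quadMasks : List ℕ :=
  codeMasks.filter fun n =>
    weight n == 8 && linMasks.all fun l => linMasks.all fun l' => n != l ^^^ l'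

/-- The word encoded by `n`. -/
def word {S : Type*} (e : Fin 21 ≃ S) (n : ℕ) : S → ZMod 2 := fun p => (bit n (e.symm p) : ZMod 2)

/-- The support of a word. -/
def suppFin {S : Type*} (e : Fin 21 ≃ S) (c : S → ZMod 2) : Finset (Fin 21) := {i | c (e i) = 1}

/-! ### Counting subsets with bounded intersections -/

/-- Base 16 number with the digits `f q`, `q ∈ l`. -/
def pack {α : Type*} (l : List α) (f : α → ℕ) : ℕ := l.foldr (fun q s => f q + 16 * s) 0

/-- The number of `k`-element sublists whose sum plus `s` has no binary digit in common
with `M`. -/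
def countSum (M : ℕ) : List ℕ → ℕ → ℕ → ℕ
  | _, 0, s => if s &&& M = 0 then 1 else 0
  | [], _ + 1, _ => 0
  | w :: l, k + 1, s => countSum M l k (s + w) + countSum M l (k + 1) s

theorem countSum_map {ι : Type*} [DecidableEq ι] (M : ℕ) (w : ι → ℕ) {l : List ι}
    (hl : l.Nodup) (k s : ℕ) :
    countSum M (l.map w) k s =
      Finset.card {c ∈ Finset.powersetCard k l.toFinset | (s + ∑ i ∈ c, w i) &&& M = 0} := by
  induction l generalizing k s with
  | nil =>
    cases k with
    | zero =>
      by_cases h : s &&& M = 0 <;> simp [countSum, Finset.filter_singleton, h]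
    | succ k => simp [countSum, Finset.powersetCard_eq_empty.2 (Finset.card_empty.trans_lt k.succ_pos)]
  | cons a l ih =>
    have ha : a ∉ l.toFinset := by simpa using (List.nodup_cons.1 hl).1
    cases k with
    | zero =>
      by_cases h : s &&& M = 0 <;> simp [countSum, Finset.filter_singleton, h]
    | succ k =>
      have hmem : ∀ c ∈ Finset.powersetCard k l.toFinset, a ∉ c := fun c hc h =>
        ha ((Finset.mem_powersetCard.1 hc).1 h)
      rw [List.map_cons, countSum, ih (List.nodup_cons.1 hl).2, ih (List.nodup_cons.1 hl).2,
        List.toFinset_cons, Finset.powersetCard_succ_insert ha, Finset.filter_union,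
        Finset.card_union_of_disjoint, add_comm]
      · congr 1
        rw [Finset.filter_image, Finset.card_image_of_injOn]
        · congr 1
          refine Finset.filter_congr fun c hc => ?_
          rw [Finset.sum_insert (hmem c hc), add_assoc]
        · intro c hc d hd h
          have hc := hmem c (Finset.mem_filter.1 hc).1
          have hd := hmem d (Finset.mem_filter.1 hd).1
          rw [← Finset.erase_insert hc, ← Finset.erase_insert hd]
          exact congrArg (Finset.erase · a) h
      · rw [Finset.disjoint_left]
        intro c hc hd
        obtain ⟨d, -, rfl⟩ := Finset.mem_image.1 (Finset.mem_filter.1 hd).1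
        exact ha ((Finset.mem_powersetCard.1 (Finset.mem_filter.1 hc).1).1
          (Finset.mem_insert_self a d))

theorem pack_add {α : Type*} (l : List α) (f g : α → ℕ) :
    pack l f + pack l g = pack l fun q => f q + g q := by
  induction l with
  | nil => rfl
  | cons q l ih =>
    simp only [pack, List.foldr_cons] at ih ⊢
    rw [← ih]; ring

theorem pack_sum {α ι : Type*} (l : List α) (c : Finset ι) (f : ι → α → ℕ) :
    ∑ i ∈ c, pack l (f i) = pack l fun q => ∑ i ∈ c, f i q := by
  classical
  induction c using Finset.induction_on with
  | empty =>
    induction l with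
    | nil => rfl
    | cons q l ih => simpa [pack, eq_comm] using ih
  | insert a c ha ih => simp only [Finset.sum_insert ha, ih, pack_add]

theorem pack_land_eq_zero {α : Type*} (l : List α) (f : α → ℕ) (hf : ∀ q ∈ l, f q < 16) :
    pack l f &&& pack l (fun _ => 8) = 0 ↔ ∀ q ∈ l, f q < 8 := by
  induction l with
  | nil => simp [pack]
  | cons q l ih =>
    have hq : f q < 16 := hf q (by simp)
    have ih := ih fun r hr => hf r (by simp [hr])
    simp only [pack, List.foldr_cons, List.forall_mem_cons] at ih ⊢
    rw [← ih]
    generalize l.foldr (fun q s => f q + 16 * s) 0 = A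
    generalize l.foldr (fun _ s => 8 + 16 * s) 0 = B
    generalize f q = x at hq
    have hdiv : ((x + 16 * A) &&& (8 + 16 * B)) / 2 ^ 4 = A &&& B := by
      rw [Nat.and_div_two_pow]; congr 1 <;> omega
    have hmod : ((x + 16 * A) &&& (8 + 16 * B)) % 2 ^ 4 = x &&& 8 := by
      rw [Nat.and_mod_two_pow]; congr 1 <;> omega
    have hx : x &&& 8 = 0 ↔ x < 8 := by
      clear hdiv hmod; interval_cases x <;> decide
    rw [← hx, ← hdiv, ← hmod]
    omega

/-- The conditions on the intersections with linear and quadratic words: a subset of six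
elements satisfies the condition `(q, s)` if it meets `q` in fewer than `8 - s` points. -/
def constraints : List (ℕ × ℕ) := linMasks.map (·, 5) ++ quadMasks.map (·, 3)

/-- The incidence vectors of the 21 points with the words in `constraints`. -/
def packedPoints : List ℕ :=
  [476144338103611433395030395711474112988134396080825135929644686453609661938532353,
   31083176675801270850635081863811590102779278914288052239030536699207261444137482780673,
   135800333832666219016924305133429836232585022173888957009534549717083795757264423060771073,
   497330824967383911388644573386580914434725421748227273706769471817957130371181656932353,
   135273991979678810554076523974888337316015086798452364178701951503356194366700747753521168,
   476253315345930095043535860717317841632201808760252520240829227140382537061237008,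
   2064589632853400971961760764266884368283760253289514838082229666823967085514720346128,
   7618200400376637498023945518365508360749994045148701386562874559879476952743022608,
   7959114451448812114012042651346646816652012463042604918841463935166302140739259178487808,
   127843283970726748962941114624570210474603946081911013318253384843478767300183430689456128,
   8454616437625262882685452965144529418741046074921984046062101862430326847989795130441728,
   7990205246202410372845197313134106417202371766588557633638479213982047384644410788544768,
   127316691189797607887722905437825461847207865271645110066771923703023964233364945174003968,
   127814014455973649126281327673585192933571563546276933229125159323444072385984730855641088,
   127345952669629561046565696124882782583274641274800701905841794192129027010651598784299008,
   8485699138171260133933441586431068103756350355375004125611648110295581369888160037797888,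
   2072148655776704782577396446637392629676544457353169758531206597632095846328327733248,
   31082704128737406211824824659018081240639538966752448714527669839238600118153434370048,
   135802398422299072417896266894180764275765415131832887460614889802190326065170447060697088,
   497323266052589763363111514608002783034769252010216162920388530881605444554031634645248,
   135271920303461968543538977824675990367963299849749505834321187736905350371642448707321873]

theorem map_pack_constraints :
    ((List.finRange 21).map fun i : Fin 21 => pack constraints fun q => bit q.1 i) =
      packedPoints := by
  decide +kernel

theorem pack_constraints_snd :
    pack constraints Prod.snd =
      407407195266897217253689137681875632210293678733187250127228089870876259952667350399276373 := by
  decide +kernel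

theorem pack_constraints_eight : pack constraints (fun _ => 8) = 8 * (16 ^ 75 / 15) := by
  decide +kernel

theorem countSum_constraints :
    countSum (pack constraints fun _ => 8)
      ((List.finRange 21).map fun i : Fin 21 => pack constraints fun q => bit q.1 i) 6
      (pack constraints Prod.snd) = 1374 := by
  rw [map_pack_constraints, pack_constraints_snd, pack_constraints_eight]
  decide +kernel

theorem card_centers :
    ((Finset.powersetCard 6 Finset.univ).filter fun c : Finset (Fin 21) =>
      (∀ n ∈ linMasks, ∑ i ∈ c, bit n i ≤ 2) ∧ ∀ n ∈ quadMasks, ∑ i ∈ c, bit n i ≤ 4).card =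
      1374 := by
  have h := countSum_constraints
  rw [countSum_map _ (fun i : Fin 21 => pack constraints fun q => bit q.1 i)
    (List.nodup_finRange 21), List.toFinset_finRange] at h
  refine (congrArg Finset.card (Finset.filter_congr fun c hc => ?_)).trans h
  have hle : ∀ n, ∑ i ∈ c, bit n i ≤ 6 := fun n => by
    rw [← (Finset.mem_powersetCard.1 hc).2, Finset.card_eq_sum_ones]
    exact Finset.sum_le_sum fun i _ => Nat.le_of_lt_succ (Nat.mod_lt _ two_pos)
  rw [pack_sum, pack_add, pack_land_eq_zero]
  · simp only [constraints, List.forall_mem_append, List.forall_mem_map]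
    refine and_congr (forall₂_congr fun n _ => ?_) (forall₂_congr fun n _ => ?_) <;> omega
  · simp only [constraints, List.forall_mem_append, List.forall_mem_map]
    exact ⟨fun n _ => by have := hle n; omega, fun n _ => by have := hle n; omega⟩

/-! ### Encoded words -/

section Words

variable {S : Type*} (e : Fin 21 ≃ S)

theorem bit_le_one (n i : ℕ) : bit n i ≤ 1 := Nat.le_of_lt_succ (Nat.mod_lt _ two_pos)

theorem bit_eq_toNat_testBit (n i : ℕ) : bit n i = (n.testBit i).toNat :=
  (Nat.toNat_testBit n i).symm

theorem natCast_bit_eq_one (n i : ℕ) : (bit n i : ZMod 2) = 1 ↔ bit n i = 1 := by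
  have := bit_le_one n i
  interval_cases bit n i <;> decide

theorem word_xor (m n : ℕ) : word e (m ^^^ n) = word e m + word e n := by
  funext p
  simp only [word, Pi.add_apply, bit_eq_toNat_testBit, Nat.testBit_xor]
  cases m.testBit (e.symm p) <;> cases n.testBit (e.symm p) <;> decide

theorem word_zero : word e 0 = 0 := by
  funext p
  simp [word, bit]

theorem word_injOn : Set.InjOn (word e) {n | n < 2 ^ 21} := by
  intro m hm n hn h
  refine Nat.eq_of_testBit_eq fun i => ?_
  by_cases hi : i < 21
  · have h' := congrFun h (e ⟨i, hi⟩)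
    simp only [word, Equiv.symm_apply_apply, bit_eq_toNat_testBit] at h'
    revert h'
    cases m.testBit i <;> cases n.testBit i <;> decide
  · have hp : 2 ^ 21 ≤ 2 ^ i := Nat.pow_le_pow_right two_pos (by omega)
    rw [Nat.testBit_lt_two_pow (lt_of_lt_of_le hm hp),
      Nat.testBit_lt_two_pow (lt_of_lt_of_le hn hp)]

theorem ncard_inter_word (c : S → ZMod 2) (n : ℕ) :
    ({x | c x = 1} ∩ {x | word e n x = 1}).ncard = ∑ i ∈ suppFin e c, bit n i := by
  have : {x | c x = 1} ∩ {x | word e n x = 1} =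
      e '' ↑((suppFin e c).filter fun i : Fin 21 => bit n i = 1) := by
    ext x
    obtain ⟨i, rfl⟩ := e.surjective x
    simp [suppFin, word, natCast_bit_eq_one]
  rw [this, Set.ncard_image_of_injective _ e.injective, Set.ncard_coe_finset, Finset.card_filter]
  refine Finset.sum_congr rfl fun i _ => ?_
  have := bit_le_one n i
  interval_cases bit n i <;> rfl

theorem wt_eq_card_suppFin (c : S → ZMod 2) : wt c = (suppFin e c).card := by
  have : {x | c x = 1} = e '' ↑(suppFin e c) := by
    ext x
    obtain ⟨i, rfl⟩ := e.surjective x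
    simp [suppFin]
  rw [wt, this, Set.ncard_image_of_injective _ e.injective, Set.ncard_coe_finset]

theorem wt_word (n : ℕ) : wt (word e n) = weight n := by
  have h := ncard_inter_word e (fun _ => 1) n
  simpa [wt, suppFin, weight, Fin.sum_univ_def] using h

theorem suppFin_bijective : Function.Bijective (suppFin e) := by
  constructor
  · intro c d h
    funext x
    obtain ⟨i, rfl⟩ := e.surjective x
    have hi : c (e i) = 1 ↔ d (e i) = 1 := by
      simpa [suppFin] using Finset.ext_iff.1 h i
    revert hi
    generalize c (e i) = a
    generalize d (e i) = b
    revert a b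
    decide
  · intro s
    exact ⟨fun x => if e.symm x ∈ s then 1 else 0, by ext i; simp [suppFin]⟩

theorem zero_mem_combos (l : List ℕ) : 0 ∈ combos l := by
  induction l with
  | nil => simp [combos]
  | cons b l ih => simp [combos, ih]

theorem mem_combos_cons {b n : ℕ} {l : List ℕ} :
    n ∈ combos (b :: l) ↔ n ∈ combos l ∨ b ^^^ n ∈ combos l := by
  simp only [combos, List.mem_append, List.mem_map]
  refine or_congr_right ⟨?_, fun h => ⟨_, h, by simp⟩⟩
  rintro ⟨m, hm, rfl⟩
  simpa [← Nat.xor_assoc] using hm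

theorem xor_mem_combos {l : List ℕ} {m n : ℕ} (hm : m ∈ combos l) (hn : n ∈ combos l) :
    m ^^^ n ∈ combos l := by
  induction l generalizing m n with
  | nil => simp_all [combos]
  | cons b l ih =>
    rw [mem_combos_cons] at *
    rcases hm with hm | hm <;> rcases hn with hn | hn
    · exact .inl (ih hm hn)
    · refine .inr ?_
      rw [Nat.xor_left_comm]
      exact ih hm hn
    · refine .inr ?_
      rw [← Nat.xor_assoc]
      exact ih hm hn
    · refine .inl ?_
      have h := ih hm hn
      rwa [Nat.xor_comm b m, Nat.xor_assoc, ← Nat.xor_assoc b b, Nat.xor_self,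
        Nat.zero_xor] at h

theorem word_mem_of_mem_combos (C : Submodule (ZMod 2) (S → ZMod 2)) {l : List ℕ}
    (hl : ∀ b ∈ l, word e b ∈ C) {n : ℕ} (hn : n ∈ combos l) : word e n ∈ C := by
  induction l generalizing n with
  | nil =>
    obtain rfl : n = 0 := by simpa [combos] using hn
    rw [word_zero]
    exact C.zero_mem
  | cons b l ih =>
    have ih {n} := ih (n := n) fun b hb => hl b (by simp [hb])
    rcases mem_combos_cons.1 hn with hn | hn
    · exact ih hn
    · have h := C.add_mem (hl b (by simp)) (ih hn)
      rwa [← word_xor, ← Nat.xor_assoc, Nat.xor_self, Nat.zero_xor] at h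

theorem codeMasks_lt : ∀ n ∈ codeMasks, n < 2 ^ 21 := by decide +kernel

variable {e} {C : Submodule (ZMod 2) (S → ZMod 2)}

theorem isLinearWord_iff (hC : ∀ w, w ∈ C ↔ ∃ n ∈ codeMasks, w = word e n) (w : S → ZMod 2) :
    IsLinearWord C w ↔ ∃ n ∈ linMasks, w = word e n := by
  simp only [IsLinearWord, hC, linMasks, List.mem_filter, beq_iff_eq]
  constructor
  · rintro ⟨⟨n, hn, rfl⟩, h⟩
    exact ⟨n, ⟨hn, wt_word e n ▸ h⟩, rfl⟩
  · rintro ⟨n, ⟨hn, h⟩, rfl⟩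
    exact ⟨⟨n, hn, rfl⟩, (wt_word e n).trans h⟩

theorem isQuadraticWord_iff (hC : ∀ w, w ∈ C ↔ ∃ n ∈ codeMasks, w = word e n)
    (w : S → ZMod 2) : IsQuadraticWord C w ↔ ∃ n ∈ quadMasks, w = word e n := by
  have key : ∀ n ∈ codeMasks,
      (∃ l₁ l₂ : S → ZMod 2, IsLinearWord C l₁ ∧ IsLinearWord C l₂ ∧ word e n = l₁ + l₂) ↔
        ∃ l ∈ linMasks, ∃ l' ∈ linMasks, n = l ^^^ l' := by
    intro n hn
    simp only [isLinearWord_iff hC]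
    constructor
    · rintro ⟨_, _, ⟨l, hl, rfl⟩, ⟨l', hl', rfl⟩, h⟩
      rw [← word_xor] at h
      refine ⟨l, hl, l', hl', word_injOn e (codeMasks_lt n hn) (Nat.xor_lt_two_pow ?_ ?_) h⟩
      · exact codeMasks_lt _ (List.mem_filter.1 hl).1
      · exact codeMasks_lt _ (List.mem_filter.1 hl').1
    · rintro ⟨l, hl, l', hl', rfl⟩
      exact ⟨_, _, ⟨l, hl, rfl⟩, ⟨l', hl', rfl⟩, word_xor e l l'⟩
  have hquad : ∀ n, n ∈ quadMasks ↔ n ∈ codeMasks ∧ weight n = 8 ∧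
      ¬ ∃ l ∈ linMasks, ∃ l' ∈ linMasks, n = l ^^^ l' := by
    intro n
    simp [quadMasks]
  simp only [IsQuadraticWord, hquad]
  constructor
  · rintro ⟨hw, h8, h⟩
    obtain ⟨n, hn, rfl⟩ := (hC w).1 hw
    exact ⟨n, ⟨hn, wt_word e n ▸ h8, (key n hn).not.1 h⟩, rfl⟩
  · rintro ⟨n, ⟨hn, h8, h⟩, rfl⟩
    exact ⟨(hC _).2 ⟨n, hn, rfl⟩, (wt_word e n).trans h8, (key n hn).not.2 h⟩

theorem ncard_isCremonaCenter (hC : ∀ w, w ∈ C ↔ ∃ n ∈ codeMasks, w = word e n) :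
    {c : S → ZMod 2 | IsCremonaCenter C c}.ncard = 1374 := by
  have hinj := (suppFin_bijective e).injective
  rw [← card_centers, ← Set.ncard_coe_finset, ← Set.ncard_image_of_injective _ hinj]
  congr 1
  ext s
  obtain ⟨c, rfl⟩ := (suppFin_bijective e).surjective s
  rw [hinj.mem_set_image]
  simp only [Set.mem_ofPred_eq, IsCremonaCenter, isLinearWord_iff hC, isQuadraticWord_iff hC,
    wt_eq_card_suppFin e, Finset.coe_filter, Finset.mem_powersetCard, Finset.subset_univ, true_and]
  refine and_congr_right fun _ => and_congr ?_ ?_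
  all_goals
    constructor
    · intro h n hn
      rw [← ncard_inter_word]
      exact h _ ⟨n, hn, rfl⟩
    · rintro h _ ⟨n, hn, rfl⟩
      rw [ncard_inter_word]
      exact h n hn

end Words

/-! ### Coordinates on the plane -/

/-- An isomorphism of a field with the model of the four-element field on `Fin 4`. -/
structure FieldNumbering (F : Type*) [Field F] where
  /-- The underlying bijection. -/
  el : Fin 4 ≃ F
  el_zero : el 0 = 0
  el_one : el 1 = 1
  el_xor : ∀ a b, el (a ^^^ b) = el a + el b
  el_mul : ∀ a b, el (mul4 a b) = el a * el b

theorem nonempty_fieldNumbering (F : Type*) [Field F] [Fintype F] (hF : Fintype.card F = 4) :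
    Nonempty (FieldNumbering F) := by
  classical
  have h2 : (2 : F) = 0 := by
    have h4 : (4 : F) = 0 := by simpa [hF] using Nat.cast_card_eq_zero F
    have : (2 : F) * 2 = 0 := by linear_combination h4
    simpa using this
  obtain ⟨ω, hω⟩ : ∃ ω : F, ω ∉ ({0, 1} : Finset F) := by
    by_contra! h
    have h1 := Finset.card_le_card fun x (_ : x ∈ Finset.univ) => h x
    rw [Finset.card_univ, hF] at h1
    have h2 := Finset.card_le_two (a := (0 : F)) (b := 1)
    omega
  obtain ⟨h0, h1⟩ : ω ≠ 0 ∧ ω ≠ 1 := by simpa using hω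
  have hsq : ω ^ 2 = ω + 1 := by
    have h4 : ω ^ 4 = ω := hF ▸ FiniteField.pow_card ω
    have h5 : ω * ((ω - 1) * (ω ^ 2 + ω + 1)) = 0 := by linear_combination h4
    have h6 := (mul_eq_zero.1 ((mul_eq_zero.1 h5).resolve_left h0)).resolve_left (sub_ne_zero.2 h1)
    linear_combination h6 - (ω + 1) * h2
  have hω1 : ω + 1 ≠ 0 := fun h => h1 (by linear_combination h - h2)
  have hinj : Function.Injective ![0, 1, ω, ω + 1] := by
    intro a b
    fin_cases a <;> fin_cases b <;> simp [h0, h1, h0.symm, h1.symm, hω1, hω1.symm]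
  have hbij := (Fintype.bijective_iff_injective_and_card ![0, 1, ω, ω + 1]).2 ⟨hinj, by simp [hF]⟩
  refine ⟨⟨Equiv.ofBijective _ hbij, rfl, rfl, fun a b => ?_, fun a b => ?_⟩⟩
  · simp only [Equiv.ofBijective_apply]
    fin_cases a <;> fin_cases b
    all_goals
      first
      | (change (0 : F) = _; simp; done)
      | (change (0 : F) = _; simp; linear_combination -h2)
      | (change (0 : F) = _; simp; linear_combination -ω * h2)
      | (change (0 : F) = _; simp; linear_combination -(ω + 1) * h2)
      | (change (1 : F) = _; simp; done)
      | (change (1 : F) = _; simp; linear_combination -ω * h2)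
      | (change ω = _; simp; done)
      | (change ω = _; simp; linear_combination -h2)
      | (change ω + 1 = _; simp; done)
      | (change ω + 1 = _; simp; ring)
  · simp only [Equiv.ofBijective_apply]
    fin_cases a <;> fin_cases b
    all_goals
      first
      | (change (0 : F) = _; simp)
      | (change (1 : F) = _; simp; done)
      | (change (1 : F) = _; simp; linear_combination -hsq - ω * h2)
      | (change ω = _; simp; done)
      | (change ω = _; simp; linear_combination -hsq - (ω + 1) * h2)
      | (change ω + 1 = _; simp; done)
      | (change ω + 1 = _; simp; linear_combination -hsq)

section Plane

open Projectivization Module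

variable {F : Type*} [Field F] (ν : FieldNumbering F) (b : Basis (Fin 3) F (Fin 3 → F))

/-- The vector with numbered coordinates `a` in the basis `b`. -/
noncomputable def coordVec (a : Fin 3 → Fin 4) : Fin 3 → F := b.equivFun.symm fun j => ν.el (a j)

theorem coordVec_injective : Function.Injective (coordVec ν b) := fun _ _ h =>
  funext fun j => ν.el.injective (congrFun (b.equivFun.symm.injective h) j)

theorem coordVec_zero : coordVec ν b 0 = 0 := by
  simp [coordVec, ν.el_zero, Basis.equivFun_symm_apply]

theorem el_smul_coordVec (u : Fin 4) (a : Fin 3 → Fin 4) :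
    ν.el u • coordVec ν b a = coordVec ν b fun j => mul4 u (a j) := by
  simp only [coordVec, ← map_smul]
  congr 1
  funext j
  simp [ν.el_mul]

theorem apply_coordVec (φ : (Fin 3 → F) →ₗ[F] F) (a p : Fin 3 → Fin 4)
    (hφ : ∀ j, φ (b j) = ν.el (a j)) : φ (coordVec ν b p) = ν.el (dot4 a p) := by
  simp only [coordVec, Basis.equivFun_symm_apply, Fin.sum_univ_three, map_add, map_smul, hφ,
    dot4, ν.el_xor, ν.el_mul, smul_eq_mul, mul_comm]

theorem coords_ne_zero (i : Fin 21) : coords i ≠ 0 := by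
  revert i
  decide +kernel

theorem coordVec_ne_zero {a : Fin 3 → Fin 4} (ha : a ≠ 0) : coordVec ν b a ≠ 0 := fun h =>
  ha (coordVec_injective ν b (h.trans (coordVec_zero ν b).symm))

/-- The `i`-th point of the plane in the coordinates given by the basis `b`. -/
noncomputable def point (i : Fin 21) : Projectivization F (Fin 3 → F) :=
  mk F (coordVec ν b (coords i)) (coordVec_ne_zero ν b (coords_ne_zero i))

theorem eq_of_mul4_coords : ∀ (u : Fin 4) (i j : Fin 21),
    (∀ k, mul4 u (coords i k) = coords j k) → i = j := by
  decide +kernel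

theorem point_bijective : Function.Bijective (point ν b) := by
  have : Fintype F := Fintype.ofEquiv _ ν.el
  have hF : Nat.card F = 4 := by rw [← Nat.card_congr ν.el, Nat.card_fin]
  have : Fintype (Projectivization F (Fin 3 → F)) := Fintype.ofFinite _
  refine (Fintype.bijective_iff_injective_and_card _).2 ⟨fun i j h => ?_, ?_⟩
  · obtain ⟨a, ha⟩ := (mk_eq_mk_iff' F _ _ _ _).1 h
    obtain ⟨u, rfl⟩ := ν.el.surjective a
    rw [el_smul_coordVec] at ha
    exact (eq_of_mul4_coords u j i (congrFun (coordVec_injective ν b ha))).symm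
  · rw [← Nat.card_eq_fintype_card (α := Projectivization F (Fin 3 → F)),
      card_of_finrank F (Fin 3 → F) (n := 3) (by simp), hF]
    simp [Finset.sum_range_succ]

/-- The numbering of the points of the plane in the coordinates given by the basis `b`. -/
noncomputable def pointEquiv : Fin 21 ≃ Projectivization F (Fin 3 → F) :=
  Equiv.ofBijective _ (point_bijective ν b)

theorem bit_lineMask : ∀ (a : Fin 3 → Fin 4) (i : Fin 21),
    bit (lineMask a) i = if dot4 a (coords i) = 0 then 1 else 0 := by
  decide +kernel

theorem lineMask_mem_combos : ∀ a : Fin 3 → Fin 4, a ≠ 0 → lineMask a ∈ combos basisMasks := by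
  decide +kernel

theorem indicator_line_eq_word (φ : (Fin 3 → F) →ₗ[F] F) (a : Fin 3 → Fin 4)
    (hφ : ∀ j, φ (b j) = ν.el (a j)) :
    Set.indicator {P : Projectivization F (Fin 3 → F) | φ P.rep = 0} (fun _ => (1 : ZMod 2)) =
      word (pointEquiv ν b) (lineMask a) := by
  classical
  funext P
  obtain ⟨i, rfl⟩ := (pointEquiv ν b).surjective P
  have h : φ (pointEquiv ν b i).rep = 0 ↔ dot4 a (coords i) = 0 := by
    obtain ⟨u, hu⟩ := exists_smul_eq_mk_rep F (coordVec ν b (coords i))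
      (coordVec_ne_zero ν b (coords_ne_zero i))
    change φ (mk F _ _).rep = 0 ↔ _
    rw [← hu, Units.smul_def, map_smul, smul_eq_mul, mul_eq_zero, or_iff_right u.ne_zero,
      apply_coordVec ν b φ a _ hφ, ← ν.el_zero, ν.el.injective.eq_iff]
  simp only [Set.indicator_apply, Set.mem_ofPred_eq, h, word, Equiv.symm_apply_apply,
    bit_lineMask]
  split_ifs <;> simp

theorem mem_CDK_iff (w : Projectivization F (Fin 3 → F) → ZMod 2) :
    w ∈ CDK F ↔ ∃ n ∈ combos basisMasks, w = word (pointEquiv ν b) n := by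
  constructor
  · intro hw
    induction hw using Submodule.span_induction with
    | mem w hw =>
      obtain ⟨L, ⟨φ, hφ, rfl⟩, rfl⟩ := hw
      refine ⟨_, lineMask_mem_combos (fun j => ν.el.symm (φ (b j))) fun h => hφ ?_,
        indicator_line_eq_word ν b φ _ fun j => by simp⟩
      refine b.ext fun j => ?_
      have hj := congrFun h j
      rw [ν.el.symm_apply_eq] at hj
      simpa [ν.el_zero] using hj
    | zero => exact ⟨0, zero_mem_combos _, (word_zero _).symm⟩
    | add _ _ _ _ h h' =>
      obtain ⟨m, hm, rfl⟩ := h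
      obtain ⟨n, hn, rfl⟩ := h'
      exact ⟨_, xor_mem_combos hm hn, (word_xor _ m n).symm⟩
    | smul r _ _ h =>
      obtain ⟨m, hm, rfl⟩ := h
      rcases Fin.exists_fin_two.1 ⟨r, rfl⟩ with rfl | rfl
      · exact ⟨0, zero_mem_combos _, by rw [word_zero]; exact zero_smul _ _⟩
      · exact ⟨m, hm, one_smul _ _⟩
  · rintro ⟨n, hn, rfl⟩
    refine word_mem_of_mem_combos _ _ (fun m hm => ?_) hn
    obtain ⟨i, -, rfl⟩ := List.mem_map.1 hm
    have hφ : ∀ j, b.constr F (fun j => ν.el (coords i j)) (b j) = ν.el (coords i j) := fun j =>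
      b.constr_basis F _ j
    rw [← indicator_line_eq_word ν b _ _ hφ]
    refine Submodule.subset_span ⟨_, ⟨_, fun h => coords_ne_zero i (funext fun j => ?_), rfl⟩, rfl⟩
    have hj := hφ j
    rw [h, LinearMap.zero_apply, ← ν.el_zero] at hj
    exact (ν.el.injective hj).symm

theorem mem_CF_iff {Fs : Finset (Projectivization F (Fin 3 → F))}
    (hFs : Fs = ({0, 4, 16, 20} : Finset (Fin 21)).map (pointEquiv ν b).toEmbedding)
    (w : Projectivization F (Fin 3 → F) → ZMod 2) :
    w ∈ CF F Fs ↔ ∃ n ∈ codeMasks, w = word (pointEquiv ν b) n := by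
  have key : ∀ n, word (pointEquiv ν b) n ∈ LinearMap.ker (∑ x ∈ Fs,
      (LinearMap.proj x : (Projectivization F (Fin 3 → F) → ZMod 2) →ₗ[ZMod 2] ZMod 2)) ↔
      (bit n 0 + bit n 4 + bit n 16 + bit n 20) % 2 = 0 := by
    intro n
    rw [← Nat.even_iff, ← ZMod.natCast_eq_zero_iff_even, LinearMap.mem_ker, LinearMap.sum_apply,
      hFs, Finset.sum_map]
    simp [word, Finset.sum_insert, add_assoc]
  simp only [CF, Submodule.mem_inf, mem_CDK_iff ν b, codeMasks, List.mem_filter, beq_iff_eq]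
  constructor
  · rintro ⟨⟨n, hn, rfl⟩, h⟩
    exact ⟨n, ⟨hn, (key n).1 h⟩, rfl⟩
  · rintro ⟨n, ⟨hn, h⟩, rfl⟩
    exact ⟨⟨n, hn, rfl⟩, (key n).2 h⟩

/-- Four points with exactly one collinear triple can be put into standard position. -/
theorem exists_basis_of_existsUnique_collinSet {Fs : Finset (Projectivization F (Fin 3 → F))}
    (hcard : Fs.card = 4)
    (hconf : ∃! T : Finset (Projectivization F (Fin 3 → F)),
      T ⊆ Fs ∧ T.card = 3 ∧ CollinSet F ↑T) :
    ∃ (b : Basis (Fin 3) F (Fin 3 → F)) (h : b 0 + b 1 ≠ 0),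
      (Fs : Set (Projectivization F (Fin 3 → F))) =
        {mk F (b 0) (b.ne_zero 0), mk F (b 0 + b 1) h, mk F (b 1) (b.ne_zero 1),
          mk F (b 2) (b.ne_zero 2)} := by
  classical
  obtain ⟨T, ⟨hT, hT3, L, ⟨φ, hφ, rfl⟩, hL⟩, huniq⟩ := hconf
  obtain ⟨p, q, r, hpq, hpr, hqr, rfl⟩ := Finset.card_eq_three.1 hT3
  obtain ⟨s, hs⟩ := Finset.card_eq_one.1
    (show (Fs \ {p, q, r}).card = 1 by rw [Finset.card_sdiff_of_subset hT]; omega)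
  have hFs : Fs = {p, q, r, s} := by
    rw [← Finset.union_sdiff_of_subset hT, hs]
    ext x
    simp
  have hs' : s ∈ Fs ∧ s ∉ ({p, q, r} : Finset _) :=
    Finset.mem_sdiff.1 (hs ▸ Finset.mem_singleton_self s)
  obtain ⟨hp, hq, hr⟩ : φ p.rep = 0 ∧ φ q.rep = 0 ∧ φ r.rep = 0 := by
    simpa [Set.insert_subset_iff] using hL
  obtain ⟨hsp, hsq, -⟩ : s ≠ p ∧ s ≠ q ∧ s ≠ r := by simpa using hs'.2
  have hφs : φ s.rep ≠ 0 := by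
    intro h
    refine hs'.2 (huniq {p, q, s} ⟨?_, ?_, _, ⟨φ, hφ, rfl⟩, ?_⟩ ▸ by simp)
    · rw [hFs]
      gcongr
      simp
    · exact Finset.card_eq_three.2 ⟨p, q, s, hpq, hsp.symm, hsq.symm, rfl⟩
    · simp [Set.insert_subset_iff, hp, hq, h]
  have heq : ∀ (x y : Projectivization F (Fin 3 → F)) (a : F), a • x.rep = y.rep → x = y := by
    intro x y a h
    rw [← x.mk_rep, ← y.mk_rep, eq_comm, mk_eq_mk_iff']
    exact ⟨a, h⟩
  have hpair := (LinearIndependent.pair_iff' p.rep_nonzero).2 fun a h => hpq (heq p q a h)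
  have hli : LinearIndependent F ![p.rep, q.rep, s.rep] := by
    refine Fintype.linearIndependent_iff.2 fun g hg => ?_
    simp only [Fin.sum_univ_three, Matrix.cons_val] at hg
    have h2 : g 2 = 0 := by simpa [hp, hq, hφs] using congrArg φ hg
    have h01 := LinearIndependent.pair_iff.1 hpair (g 0) (g 1) (by simpa [h2] using hg)
    intro i
    fin_cases i
    exacts [h01.1, h01.2, h2]
  let b := basisOfLinearIndependentOfCardEqFinrank hli (by simp)
  have hb : ⇑b = ![p.rep, q.rep, s.rep] := coe_basisOfLinearIndependentOfCardEqFinrank hli _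
  have hrep := b.sum_repr r.rep
  simp only [Fin.sum_univ_three, hb, Matrix.cons_val] at hrep
  generalize b.repr r.rep 0 = x, b.repr r.rep 1 = y, b.repr r.rep 2 = z at hrep
  obtain rfl : z = 0 := by simpa [hp, hq, hr, hφs] using congrArg φ hrep
  rw [zero_smul, add_zero] at hrep
  have hx : x ≠ 0 := by
    rintro rfl
    exact hqr (heq q r y (by simpa using hrep))
  have hy : y ≠ 0 := by
    rintro rfl
    exact hpr (heq p r x (by simpa using hrep))
  let b' := b.unitsSMul ![Units.mk0 x hx, Units.mk0 y hy, 1]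
  have h0 : b' 0 = x • p.rep := by simp [b', Basis.unitsSMul_apply, hb, Units.smul_def]
  have h1 : b' 1 = y • q.rep := by simp [b', Basis.unitsSMul_apply, hb, Units.smul_def]
  have h2 : b' 2 = s.rep := by simp [b', Basis.unitsSMul_apply, hb]
  have h01 : b' 0 + b' 1 = r.rep := by rw [h0, h1, hrep]
  have hmk : ∀ (v : Fin 3 → F) (hv : v ≠ 0) (P : Projectivization F (Fin 3 → F)) (a : F),
      v = a • P.rep → mk F v hv = P := by
    intro v hv P a h
    conv_rhs => rw [← P.mk_rep]
    exact (mk_eq_mk_iff' F _ _ _ _).2 ⟨a, h.symm⟩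
  refine ⟨b', h01 ▸ r.rep_nonzero, ?_⟩
  rw [hmk _ _ p x h0, hmk _ _ q y h1, hmk _ _ r 1 (by rw [h01, one_smul]),
    hmk _ _ s 1 (by rw [h2, one_smul]), hFs]
  ext P
  simp
  tauto

end Plane

/-- for a four-point subset `F ⊆ P²(F₄)` with exactly one collinear triple of
points, there are exactly 1374 words of weight 6 that are centers of Cremona transformation
with respect to the code `C_F`. -/
theorem count_centers_B (F : Type*) [Field F] [Fintype F] (hF : Fintype.card F = 4)
    (Fs : Finset (Projectivization F (Fin 3 → F))) (hcard : Fs.card = 4)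
    (hconf : ∃! T : Finset (Projectivization F (Fin 3 → F)),
      T ⊆ Fs ∧ T.card = 3 ∧ CollinSet F ↑T) :
    {c : Projectivization F (Fin 3 → F) → ZMod 2 | IsCremonaCenter (CF F Fs) c}.ncard
      = 1374 := by

  obtain ⟨ν⟩ := nonempty_fieldNumbering F hF
  obtain ⟨b, h, hFs⟩ := exists_basis_of_existsUnique_collinSet hcard hconf
  refine ncard_isCremonaCenter (mem_CF_iff ν b ?_)
  have hpt : ∀ (i : Fin 21) (v : Fin 3 → F) (hv : v ≠ 0), coordVec ν b (coords i) = v →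
      Projectivization.mk F v hv = pointEquiv ν b i := by
    rintro i _ hv rfl
    rfl
  have h1 : ν.el 1 = 1 := ν.el_one
  have h0 : ν.el 0 = 0 := ν.el_zero
  rw [← Finset.coe_inj, hFs, hpt 0, hpt 4, hpt 16, hpt 20]
  · simp [Set.image_insert_eq]
  all_goals simp [coordVec, Module.Basis.equivFun_symm_apply, Fin.sum_univ_three, coords, h0, h1]
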